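/- arXiv:0711.3834 — 4 statements merged into one kernel-verified Lean document; each statement's English description precedes it below -/
import Mathlib

section
/- Let n ≥ 2 and let x₊ : ℝ → ℂ be n-times differentiable and nonvanishing on a neighborhood of t. Let L be a complex-valued function, differentiable on a neighborhood of 0, satisfying exp(L(τ)) = x₊(t+τ)·e^(−iω(t)τ) for all τ in that neighborhood. Then L′(0) = υ(t), and for every k with 2 ≤ k ≤ n, L is k-times differentiable at 0 with L^{(k)}(0) = i·η^{(k−1)}(t), where η^{(k−1)} denotes the (k−1)-st derivative of the complex instantaneous frequency t ↦ η(t). -/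
open MeasureTheory
open scoped Topology

/-- Instantaneous frequency `ω(t) = Im(x₊′(t)/x₊(t))`. -/
noncomputable def instFreq (x : ℝ → ℂ) (t : ℝ) : ℝ := (deriv x t / x t).im

/-- Instantaneous bandwidth `υ(t) = Re(x₊′(t)/x₊(t))`. -/
noncomputable def instBand (x : ℝ → ℂ) (t : ℝ) : ℝ := (deriv x t / x t).re

/-- Complex instantaneous frequency `η(t) = −i·x₊′(t)/x₊(t)`. -/
noncomputable def instEta (x : ℝ → ℂ) (t : ℝ) : ℂ := -Complex.I * (deriv x t / x t)

theorem ContDiffAt.differentiableAt_iteratedDeriv {f : ℝ → ℂ} {n m : ℕ} {s : ℝ}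
    (hf : ContDiffAt ℝ n f s) (hmn : m < n) : DifferentiableAt ℝ (iteratedDeriv m f) s := by
  rw [iteratedDeriv_eq_equiv_comp, LinearIsometryEquiv.comp_differentiableAt_iff]
  exact hf.differentiableAt_iteratedFDeriv (by exact_mod_cast hmn)

/-- If `L` is a logarithm of `f · exp (c ·)` near `s`, then `L′ = f′ / f + c` at `s`. -/
theorem deriv_eq_of_exp_eventuallyEq_mul_exp {L f : ℝ → ℂ} {c : ℂ} {s : ℝ}
    (hL : DifferentiableAt ℝ L s) (hf : DifferentiableAt ℝ f s) (hfs : f s ≠ 0)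
    (h : (fun τ => Complex.exp (L τ)) =ᶠ[𝓝 s] fun τ => f τ * Complex.exp (c * (τ : ℂ))) :
    deriv L s = deriv f s / f s + c := by
  have hc : HasDerivAt (fun τ : ℝ => c * (τ : ℂ)) c s := by
    simpa using (Complex.ofRealCLM.hasDerivAt (x := s)).const_mul c
  have key := hL.hasDerivAt.cexp.unique ((hf.hasDerivAt.mul hc.cexp).congr_of_eventuallyEq h)
  have hs : Complex.exp (L s) = f s * Complex.exp (c * (s : ℂ)) := h.eq_of_nhds
  rw [hs] at key
  have he := Complex.exp_ne_zero (c * (s : ℂ))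
  apply mul_left_cancel₀ (mul_ne_zero hfs he)
  rw [key]
  field_simp

theorem ContDiffAt.instEta {x : ℝ → ℂ} {t : ℝ} {m : ℕ} (hx : ContDiffAt ℝ (m + 1 : ℕ) x t)
    (hnz : x t ≠ 0) : ContDiffAt ℝ m (instEta x) t := by
  have hd : ContDiffAt ℝ m (deriv x) t := hx.derivWithin (by norm_cast)
  have hx' : ContDiffAt ℝ m x t := hx.of_le (by exact_mod_cast m.le_succ)
  exact contDiffAt_const.mul (hd.mul (hx'.inv hnz))

/-- Derivatives at `0` of a logarithm `L` of the demodulated signal give the bandwidth and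
the derivatives of the complex instantaneous frequency. -/
theorem derivs_of_demodulated_log (n : ℕ) (hn : 2 ≤ n) (t : ℝ) (x : ℝ → ℂ)
    (U : Set ℝ) (hU : U ∈ 𝓝 t) (hx : ContDiffOn ℝ n x U) (hnz : ∀ u ∈ U, x u ≠ 0)
    (L : ℝ → ℂ) (V : Set ℝ) (hV : V ∈ 𝓝 (0 : ℝ)) (hL : DifferentiableOn ℝ L V)
    (hexp : ∀ τ ∈ V,
      Complex.exp (L τ) = x (t + τ) * Complex.exp (-Complex.I * (instFreq x t : ℂ) * (τ : ℂ))) :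
    deriv L 0 = (instBand x t : ℂ) ∧
      ∀ k : ℕ, 2 ≤ k → k ≤ n →
        (∀ j < k, DifferentiableAt ℝ (iteratedDeriv j L) 0) ∧
          iteratedDeriv k L 0 = Complex.I * iteratedDeriv (k - 1) (instEta x) t := by
  have hxt : ContDiffAt ℝ n x t := hx.contDiffAt hU
  have hadd : Filter.Tendsto (fun τ : ℝ => t + τ) (𝓝 0) (𝓝 t) := by
    simpa using (continuous_const_add t).tendsto 0
  have hderiv : deriv L =ᶠ[𝓝 0] fun τ =>
      -Complex.I * (instFreq x t : ℂ) + Complex.I * instEta x (t + τ) := by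
    filter_upwards [eventually_mem_nhds_iff.2 hV,
      hadd.eventually (eventually_mem_nhds_iff.2 hU)] with τ hτV hτU
    have hxd : DifferentiableAt ℝ x (t + τ) :=
      (hx.contDiffAt hτU).differentiableAt (by norm_cast; omega)
    have hf : DifferentiableAt ℝ (fun τ => x (t + τ)) τ :=
      hxd.comp τ (differentiableAt_id.const_add t)
    have h := deriv_eq_of_exp_eventuallyEq_mul_exp (hL.differentiableAt hτV) hf
      (hnz _ (mem_of_mem_nhds hτU)) (Filter.mem_of_superset hτV hexp)
    rw [h, deriv_comp_const_add, instEta]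
    linear_combination (deriv x (t + τ) / x (t + τ)) * Complex.I_sq
  obtain ⟨m, rfl⟩ : ∃ m, n = m + 1 := ⟨n - 1, by omega⟩
  have heta : ContDiffAt ℝ m (instEta x) (t + 0) := by
    rw [add_zero]
    exact hxt.instEta (hnz t (mem_of_mem_nhds hU))
  have hdL : ContDiffAt ℝ m (deriv L) 0 := by
    refine ContDiffAt.congr_of_eventuallyEq ?_ hderiv
    exact contDiffAt_const.add (contDiffAt_const.mul
      (heta.comp (0 : ℝ) (contDiffAt_const.add contDiffAt_id)))
  refine ⟨?_, fun k hk hkn => ⟨fun j hj => ?_, ?_⟩⟩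
  · rw [hderiv.eq_of_nhds, add_zero, instEta, instFreq, instBand]
    linear_combination -(deriv x t / x t) * Complex.I_sq - Complex.re_add_im (deriv x t / x t)
  · cases j with
    | zero => simpa using hL.differentiableAt hV
    | succ j =>
      rw [iteratedDeriv_succ']
      exact hdL.differentiableAt_iteratedDeriv (by omega)
  · obtain ⟨k, rfl⟩ : ∃ l, k = l + 1 := ⟨k - 1, by omega⟩
    rw [iteratedDeriv_succ', hderiv.iteratedDeriv_eq, iteratedDeriv_const_add (by omega),
      iteratedDeriv_const_mul_field, iteratedDeriv_comp_const_add]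
    simp
end

section
/- Let x₊ : ℝ → ℂ be twice continuously differentiable and nonvanishing on a neighborhood of t, with ω(t) ≠ 0. Then ρ̃₁(t) = υ(t)/ω(t), and ρ̃₂(t) = υ(t)²/ω(t)² + i·η′(t)/ω(t)², which can equivalently be written as ρ̃₂(t) = ρ̃₁(t)² + υ′(t)/ω(t)² + i·ω′(t)/ω(t)². -/
open MeasureTheory
open scoped Topology

/-- The `n`-th instantaneous modulation function. -/
noncomputable def imf (x : ℝ → ℂ) (n : ℕ) (t : ℝ) : ℂ :=
  ((instFreq x t : ℂ) ^ n)⁻¹ * (x t)⁻¹ *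
    iteratedDeriv n
      (fun τ : ℝ => x (t + τ) * Complex.exp (-Complex.I * (instFreq x t : ℂ) * (τ : ℂ))) 0

/-- The derivative of a translated signal demodulated by the frequency `w`. -/
theorem hasDerivAt_translate_mul_exp {f : ℝ → ℂ} {f' : ℂ} (t τ : ℝ) (w : ℂ)
    (hf : HasDerivAt f f' (t + τ)) :
    HasDerivAt (fun s : ℝ => f (t + s) * Complex.exp (-Complex.I * w * (s : ℂ)))
      ((f' - Complex.I * w * f (t + τ)) * Complex.exp (-Complex.I * w * (τ : ℂ))) τ := by
  have hexp : HasDerivAt (fun s : ℝ => Complex.exp (-Complex.I * w * (s : ℂ)))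
      (Complex.exp (-Complex.I * w * (τ : ℂ)) * (-Complex.I * w * 1)) τ :=
    ((Complex.ofRealCLM.hasDerivAt (x := τ)).const_mul (-Complex.I * w)).cexp
  exact ((hf.comp_const_add t τ).mul hexp).congr_deriv (by ring)

theorem iteratedDeriv_one_translate_mul_exp {f : ℝ → ℂ} {t : ℝ} (w : ℂ)
    (hf : DifferentiableAt ℝ f t) :
    iteratedDeriv 1 (fun s : ℝ => f (t + s) * Complex.exp (-Complex.I * w * (s : ℂ))) 0 =
      deriv f t - Complex.I * w * f t := by
  rw [iteratedDeriv_one, (hasDerivAt_translate_mul_exp t 0 w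
    ((add_zero t).symm ▸ hf.hasDerivAt)).deriv]
  simp

theorem iteratedDeriv_two_translate_mul_exp {f : ℝ → ℂ} {t : ℝ} (w : ℂ)
    (hf : ∀ᶠ u in 𝓝 t, DifferentiableAt ℝ f u) (hf' : DifferentiableAt ℝ (deriv f) t) :
    iteratedDeriv 2 (fun s : ℝ => f (t + s) * Complex.exp (-Complex.I * w * (s : ℂ))) 0 =
      deriv (deriv f) t - 2 * Complex.I * w * deriv f t - w ^ 2 * f t := by
  have htend : Filter.Tendsto (fun s : ℝ => t + s) (𝓝 0) (𝓝 t) := by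
    simpa using (continuous_const_add t).tendsto 0
  have hderiv : deriv (fun s : ℝ => f (t + s) * Complex.exp (-Complex.I * w * (s : ℂ)))
      =ᶠ[𝓝 0] fun s : ℝ => (deriv f (t + s) - Complex.I * w * f (t + s)) *
        Complex.exp (-Complex.I * w * (s : ℂ)) := by
    filter_upwards [htend.eventually hf] with s hs
    exact (hasDerivAt_translate_mul_exp t s w hs.hasDerivAt).deriv
  have hg : HasDerivAt (fun u => deriv f u - Complex.I * w * f u)
      (deriv (deriv f) t - Complex.I * w * deriv f t) (t + 0) := by
    rw [add_zero]
    exact hf'.hasDerivAt.sub (hf.self_of_nhds.hasDerivAt.const_mul _)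
  rw [iteratedDeriv_succ, iteratedDeriv_one, hderiv.deriv_eq,
    (hasDerivAt_translate_mul_exp t 0 w hg).deriv]
  simp only [add_zero, Complex.ofReal_zero, mul_zero, Complex.exp_zero, mul_one]
  linear_combination (w ^ 2 * f t) * Complex.I_sq

theorem instBand_add_instFreq_mul_I (x : ℝ → ℂ) (t : ℝ) :
    (instBand x t : ℂ) + instFreq x t * Complex.I = deriv x t / x t :=
  Complex.re_add_im _

/-- The first and second instantaneous modulation functions:
`ρ̃₁ = υ/ω` and `ρ̃₂ = υ²/ω² + i·η′/ω² = ρ̃₁² + υ′/ω² + i·ω′/ω²`. -/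
theorem imf_one_two (t : ℝ) (x : ℝ → ℂ)
    (U : Set ℝ) (hU : U ∈ 𝓝 t) (hx : ContDiffOn ℝ 2 x U) (hnz : ∀ u ∈ U, x u ≠ 0)
    (hω : instFreq x t ≠ 0) :
    imf x 1 t = ((instBand x t / instFreq x t : ℝ) : ℂ) ∧
      imf x 2 t = (((instBand x t) ^ 2 / (instFreq x t) ^ 2 : ℝ) : ℂ)
          + Complex.I * deriv (instEta x) t / (instFreq x t : ℂ) ^ 2 ∧
      imf x 2 t = (imf x 1 t) ^ 2
          + ((deriv (fun u => instBand x u) t / (instFreq x t) ^ 2 : ℝ) : ℂ)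
          + Complex.I * ((deriv (fun u => instFreq x u) t / (instFreq x t) ^ 2 : ℝ) : ℂ) := by
  have hcd : ContDiffAt ℝ 2 x t := hx.contDiffAt hU
  have hdiff : ∀ᶠ u in 𝓝 t, DifferentiableAt ℝ x u :=
    (hcd.eventually (by simp)).mono fun u hu => hu.differentiableAt (by simp)
  have hdiff' : DifferentiableAt ℝ (deriv x) t :=
    (hcd.derivWithin (m := 1) (by norm_num)).differentiableAt one_ne_zero
  have hx0 : x t ≠ 0 := hnz t (mem_of_mem_nhds hU)
  have hω' : (instFreq x t : ℂ) ≠ 0 := Complex.ofReal_ne_zero.mpr hω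
  have hx' : deriv x t = (instBand x t + instFreq x t * Complex.I) * x t := by
    rw [instBand_add_instFreq_mul_I, div_mul_cancel₀ _ hx0]
  have hq : HasDerivAt (fun u => deriv x u / x u)
      ((deriv (deriv x) t * x t - deriv x t * deriv x t) / x t ^ 2) t :=
    hdiff'.hasDerivAt.div hdiff.self_of_nhds.hasDerivAt hx0
  set q' := (deriv (deriv x) t * x t - deriv x t * deriv x t) / x t ^ 2 with hq'
  have hband : deriv (fun u => instBand x u) t = q'.re :=
    (Complex.reCLM.hasFDerivAt.comp_hasDerivAt t hq).deriv
  have hfreq : deriv (fun u => instFreq x u) t = q'.im :=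
    (Complex.imCLM.hasFDerivAt.comp_hasDerivAt t hq).deriv
  have heta : Complex.I * deriv (instEta x) t = q' := by
    rw [show deriv (instEta x) t = -Complex.I * q' from (hq.const_mul (-Complex.I)).deriv]
    linear_combination -q' * Complex.I_sq
  have hx'' : deriv (deriv x) t =
      (q' + (instBand x t + instFreq x t * Complex.I) ^ 2) * x t := by
    rw [hq', hx']
    field_simp
    ring
  have h1 : imf x 1 t = ((instBand x t / instFreq x t : ℝ) : ℂ) := by
    rw [imf, iteratedDeriv_one_translate_mul_exp _ hdiff.self_of_nhds, hx']
    push_cast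
    field_simp
    ring
  have h2 : imf x 2 t = (((instBand x t) ^ 2 / (instFreq x t) ^ 2 : ℝ) : ℂ)
      + q' / (instFreq x t : ℂ) ^ 2 := by
    rw [imf, iteratedDeriv_two_translate_mul_exp _ hdiff hdiff', hx'', hx']
    clear_value q'
    push_cast
    field_simp
    linear_combination (-(instFreq x t : ℂ) ^ 2) * Complex.I_sq
  refine ⟨h1, by rw [h2, heta], ?_⟩
  rw [h2, h1, hband, hfreq]
  nth_rewrite 1 [← Complex.re_add_im q']
  push_cast
  ring
end

section
/- Let x₊ : ℝ → ℂ be three times continuously differentiable and nonvanishing on a neighborhood of t, with ω(t) ≠ 0. Then ρ̃₃(t) = υ(t)³/ω(t)³ + 3·(υ(t)/ω(t))·(i·η′(t)/ω(t)²) + i·η″(t)/ω(t)³. -/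
open MeasureTheory
open scoped Topology

/-- Third derivative of a solution of the linear equation `y' = g y`. -/
theorem iteratedDeriv_three_of_hasDerivAt_mul {y g : ℝ → ℂ} {s : ℝ}
    (hy : ∀ᶠ u in 𝓝 s, HasDerivAt y (g u * y u) u) (hg : ContDiffAt ℝ 2 g s) :
    iteratedDeriv 3 y s
      = (g s ^ 3 + 3 * g s * deriv g s + iteratedDeriv 2 g s) * y s := by
  have hg₁ : ∀ᶠ u in 𝓝 s, HasDerivAt g (deriv g u) u :=
    (hg.eventually (by simp)).mono fun u hu => (hu.differentiableAt (by simp)).hasDerivAt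
  have hg₂ : HasDerivAt (deriv g) (iteratedDeriv 2 g s) s := by
    have h : ContDiffAt ℝ 1 (deriv g) s := hg.derivWithin (by norm_num)
    simpa [iteratedDeriv_succ] using (h.differentiableAt (by simp)).hasDerivAt
  have hy₁ : deriv y =ᶠ[𝓝 s] fun u => g u * y u := hy.mono fun u hu => hu.deriv
  have hy₂ : deriv (deriv y) =ᶠ[𝓝 s] fun u => (deriv g u + g u ^ 2) * y u := by
    filter_upwards [hy₁.eventually_nhds, hy, hg₁] with u h₁ hyu hgu
    rw [Filter.EventuallyEq.deriv_eq h₁, (hgu.fun_mul hyu).deriv]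
    ring
  have hy₃ := (hg₂.fun_add (hg₁.self_of_nhds.fun_pow 2)).fun_mul hy.self_of_nhds
  have h₃ : iteratedDeriv 3 y s = deriv (deriv (deriv y)) s := by simp [iteratedDeriv_succ]
  rw [h₃, hy₂.deriv_eq, hy₃.deriv]
  push_cast
  ring

/-- Demodulating by `exp (-i ω τ)` shifts the logarithmic derivative by `-i ω`. -/
theorem hasDerivAt_demodulated {x : ℝ → ℂ} {t τ : ℝ} (ω : ℂ)
    (hx : DifferentiableAt ℝ x (t + τ)) (hnz : x (t + τ) ≠ 0) :
    HasDerivAt (fun τ : ℝ => x (t + τ) * Complex.exp (-Complex.I * ω * (τ : ℂ)))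
      ((Complex.I * instEta x (t + τ) - Complex.I * ω) *
        (x (t + τ) * Complex.exp (-Complex.I * ω * (τ : ℂ)))) τ := by
  have hexp : HasDerivAt (fun τ : ℝ => Complex.exp (-Complex.I * ω * (τ : ℂ)))
      (Complex.exp (-Complex.I * ω * (τ : ℂ)) * (-Complex.I * ω * 1)) τ :=
    ((Complex.ofRealCLM.hasDerivAt (x := τ)).const_mul (-Complex.I * ω)).cexp
  have hdiv : Complex.I * instEta x (t + τ) * x (t + τ) = deriv x (t + τ) := by
    rw [instEta]
    field_simp
    simp
  convert! (hx.hasDerivAt.comp_const_add t τ).fun_mul hexp using 1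
  rw [← hdiv]
  ring

theorem contDiffAt_instEta {x : ℝ → ℂ} {t : ℝ} (hx : ContDiffAt ℝ 3 x t) (hnz : x t ≠ 0) :
    ContDiffAt ℝ 2 (instEta x) t := by
  have h : ContDiffAt ℝ 2 (deriv x) t := hx.derivWithin (by norm_num)
  have h' : ContDiffAt ℝ 2 x t := hx.of_le (by norm_num)
  simpa only [instEta, div_eq_mul_inv] using!
    contDiffAt_const.mul (h.mul (h'.inv hnz))

/-- The logarithmic derivative is `υ + i ω`, and also `i η`. -/
theorem I_mul_instEta (x : ℝ → ℂ) (t : ℝ) :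
    Complex.I * instEta x t = instBand x t + Complex.I * instFreq x t := by
  have h : Complex.I * instEta x t = deriv x t / x t := by
    rw [instEta, ← mul_assoc]
    simp
  rw [h, instBand, instFreq, mul_comm Complex.I, Complex.re_add_im]

/-- The third instantaneous modulation function:
`ρ̃₃ = υ³/ω³ + 3·(υ/ω)·(i·η′/ω²) + i·η″/ω³`. -/
theorem imf_three (t : ℝ) (x : ℝ → ℂ)
    (U : Set ℝ) (hU : U ∈ 𝓝 t) (hx : ContDiffOn ℝ 3 x U) (hnz : ∀ u ∈ U, x u ≠ 0)
    (hω : instFreq x t ≠ 0) :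
    imf x 3 t = (((instBand x t) ^ 3 / (instFreq x t) ^ 3 : ℝ) : ℂ)
        + 3 * ((instBand x t / instFreq x t : ℝ) : ℂ) *
            (Complex.I * deriv (instEta x) t / (instFreq x t : ℂ) ^ 2)
        + Complex.I * iteratedDeriv 2 (instEta x) t / (instFreq x t : ℂ) ^ 3 := by
  have hxt : ContDiffAt ℝ 3 x t := hx.contDiffAt hU
  have hxt₀ : x t ≠ 0 := hnz t (mem_of_mem_nhds hU)
  have hη : ContDiffAt ℝ 2 (instEta x) t := contDiffAt_instEta hxt hxt₀
  set ω : ℂ := (instFreq x t : ℂ) with hω_def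
  have hω₀ : ω ≠ 0 := Complex.ofReal_ne_zero.mpr hω
  have htend : Filter.Tendsto (fun τ : ℝ => t + τ) (𝓝 0) (𝓝 t) := by
    simpa using (continuous_const_add t).tendsto (0 : ℝ)
  have hderiv : ∀ᶠ τ in 𝓝 (0 : ℝ),
      HasDerivAt (fun τ : ℝ => x (t + τ) * Complex.exp (-Complex.I * ω * (τ : ℂ)))
        ((Complex.I * instEta x (t + τ) - Complex.I * ω) *
          (x (t + τ) * Complex.exp (-Complex.I * ω * (τ : ℂ)))) τ := by
    filter_upwards [htend.eventually (hxt.eventually (by simp)), htend.eventually hU]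
      with τ hd hu
    exact hasDerivAt_demodulated ω (hd.differentiableAt (by simp)) (hnz _ hu)
  have hηshift : ContDiffAt ℝ 2 (fun τ : ℝ => instEta x (t + τ)) 0 :=
    ContDiffAt.comp (g := instEta x) (f := fun τ : ℝ => t + τ) (0 : ℝ)
      (by simpa only [add_zero] using hη) (contDiffAt_const.add contDiffAt_id)
  have hg : ContDiffAt ℝ 2 (fun τ : ℝ => Complex.I * instEta x (t + τ) - Complex.I * ω) 0 :=
    (contDiffAt_const.mul hηshift).sub contDiffAt_const
  have hg₁ : deriv (fun τ : ℝ => Complex.I * instEta x (t + τ) - Complex.I * ω)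
      = fun τ => Complex.I * deriv (instEta x) (t + τ) := by
    funext τ
    rw [deriv_sub_const, deriv_const_mul_field, deriv_comp_const_add]
  have hg₂ : iteratedDeriv 2 (fun τ : ℝ => Complex.I * instEta x (t + τ) - Complex.I * ω) 0
      = Complex.I * iteratedDeriv 2 (instEta x) t := by
    rw [iteratedDeriv_succ, iteratedDeriv_one, hg₁, deriv_const_mul_field,
      deriv_comp_const_add, iteratedDeriv_succ, iteratedDeriv_one, add_zero]
  rw [imf, ← hω_def, iteratedDeriv_three_of_hasDerivAt_mul hderiv hg, hg₁, hg₂]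
  simp only [add_zero, I_mul_instEta, ← hω_def, add_sub_cancel_right, Complex.ofReal_zero,
    mul_zero, Complex.exp_zero, mul_one]
  push_cast
  rw [← hω_def]
  field_simp
end

section
/- For every β > 0 and γ > 0, the generalized Morse wavelet satisfies −ω_{β,γ}²·Ψ″_{β,γ}(ω_{β,γ})/Ψ_{β,γ}(ω_{β,γ}) = βγ; in particular Ψ″_{β,γ}(ω_{β,γ}) is real and negative, and the dimensionless wavelet duration P_{β,γ} = √(−ω_{β,γ}²·Ψ″_{β,γ}(ω_{β,γ})/Ψ_{β,γ}(ω_{β,γ})) equals √(βγ). -/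
/-- The generalized Morse wavelet in the frequency domain. -/
noncomputable def morsePsi (β γ : ℝ) (ω : ℝ) : ℝ :=
  if 0 < ω then 2 * (Real.exp 1 * γ / β) ^ (β / γ) * ω ^ β * Real.exp (-(ω ^ γ)) else 0

/-- The peak frequency `ω_{β,γ} = (β/γ)^(1/γ)` of the generalized Morse wavelet. -/
noncomputable def morsePeak (β γ : ℝ) : ℝ := (β / γ) ^ (1 / γ)

theorem morsePsi_pos {β γ ω : ℝ} (hβ : 0 < β) (hγ : 0 < γ) (hω : 0 < ω) :
    0 < morsePsi β γ ω := by
  rw [morsePsi, if_pos hω]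
  positivity

theorem morsePeak_pos {β γ : ℝ} (hβ : 0 < β) (hγ : 0 < γ) : 0 < morsePeak β γ := by
  unfold morsePeak
  positivity

theorem morsePeak_rpow {β γ : ℝ} (hβ : 0 < β) (hγ : 0 < γ) :
    morsePeak β γ ^ γ = β / γ := by
  rw [morsePeak, ← Real.rpow_mul (by positivity), one_div_mul_cancel hγ.ne', Real.rpow_one]

/-- The logarithmic derivative of the Morse wavelet is `(β - γ * ω ^ γ) / ω`. -/
theorem hasDerivAt_morsePsi (β γ : ℝ) {ω : ℝ} (hω : 0 < ω) :
    HasDerivAt (morsePsi β γ) (morsePsi β γ ω * ((β - γ * ω ^ γ) / ω)) ω := by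
  have hderiv := ((Real.hasDerivAt_rpow_const (p := β) (Or.inl hω.ne')).const_mul
    (2 * (Real.exp 1 * γ / β) ^ (β / γ))).mul
      (Real.hasDerivAt_rpow_const (p := γ) (Or.inl hω.ne')).fun_neg.exp
  refine (hderiv.congr_of_eventuallyEq ?_).congr_deriv ?_
  · filter_upwards [lt_mem_nhds hω] with x hx
    simp [morsePsi, hx]
  · rw [morsePsi, if_pos hω, Real.rpow_sub_one hω.ne', Real.rpow_sub_one hω.ne']
    field_simp
    ring

theorem iteratedDeriv_two_morsePsi_morsePeak {β γ : ℝ} (hβ : 0 < β) (hγ : 0 < γ) :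
    iteratedDeriv 2 (morsePsi β γ) (morsePeak β γ) =
      -(morsePsi β γ (morsePeak β γ) * (β * γ) / morsePeak β γ ^ 2) := by
  have hω := morsePeak_pos hβ hγ
  have hpow := morsePeak_rpow hβ hγ
  rw [iteratedDeriv_succ, iteratedDeriv_one]
  have hderiv := (hasDerivAt_morsePsi β γ hω).mul
    ((((Real.hasDerivAt_rpow_const (p := γ) (Or.inl hω.ne')).const_mul γ).const_sub β).div
      (hasDerivAt_id' (morsePeak β γ)) hω.ne')
  refine ((hderiv.congr_of_eventuallyEq ?_).congr_deriv ?_).deriv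
  · filter_upwards [lt_mem_nhds hω] with x hx
    exact (hasDerivAt_morsePsi β γ hx).deriv
  · rw [Real.rpow_sub_one hω.ne', hpow]
    simp only [Pi.div_apply, hpow]
    field_simp
    ring

/-- **Duration of the generalized Morse wavelets.**
`−ω_{β,γ}²·Ψ″_{β,γ}(ω_{β,γ})/Ψ_{β,γ}(ω_{β,γ}) = βγ`; in particular `Ψ″_{β,γ}(ω_{β,γ}) < 0`
and the dimensionless duration `P_{β,γ}` equals `√(βγ)`. -/
theorem morse_duration (β γ : ℝ) (hβ : 0 < β) (hγ : 0 < γ) :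
    -(morsePeak β γ) ^ (2 : ℕ) * iteratedDeriv 2 (morsePsi β γ) (morsePeak β γ) /
        morsePsi β γ (morsePeak β γ) = β * γ ∧
      iteratedDeriv 2 (morsePsi β γ) (morsePeak β γ) < 0 ∧
      Real.sqrt (-(morsePeak β γ) ^ (2 : ℕ) *
          iteratedDeriv 2 (morsePsi β γ) (morsePeak β γ) /
          morsePsi β γ (morsePeak β γ)) = Real.sqrt (β * γ) := by
  have hω := morsePeak_pos hβ hγ
  have hΨ := morsePsi_pos hβ hγ hω
  have hratio : -(morsePeak β γ) ^ (2 : ℕ) * iteratedDeriv 2 (morsePsi β γ) (morsePeak β γ) /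
      morsePsi β γ (morsePeak β γ) = β * γ := by
    rw [iteratedDeriv_two_morsePsi_morsePeak hβ hγ]
    field_simp
  refine ⟨hratio, ?_, by rw [hratio]⟩
  rw [iteratedDeriv_two_morsePsi_morsePeak hβ hγ, neg_lt_zero]
  positivity
end
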